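/- Let S : ℝ × ℝ → EuclideanSpace ℝ (Fin 3) be twice continuously differentiable with ‖S‖ = 1, let k = ‖∂ₓS‖ > 0, and let u, v be continuously differentiable with u² < k² everywhere. Define the frame e₁ = S, e₂ = (∂ₓS)/k, e₃ = (S ×₃ ∂ₓS)/k, set τ = ⟨∂ₓe₂, e₃⟩, ω₂ = −u, ω₃ = −√(k² − u²), and assume the gauge condition ⟨∂ₜe₂, e₃⟩ = 0. Suppose S, u, v satisfy the M-LXIX system: ∂ₜS = (1/k)( −√(k² − u²) ∂ₓS + u (S ×₃ ∂ₓS) ), ∂ₓu = v √(‖∂ₜS‖² − u²), and ∂ₜv = −⟨S, ∂ₜS ×₃ ∂ₓS⟩. Then k, τ, ω₂, ω₃ satisfy at every point: ∂ₜk = ∂ₓω₃ + τ ω₂, ∂ₜτ = −k ω₂, and ∂ₓω₂ = τ ω₃. -/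

import Mathlib

open scoped InnerProductSpace

/-- Partial derivative with respect to the first variable `x`. -/
noncomputable def pX {E : Type*} [NormedAddCommGroup E] [NormedSpace ℝ E]
    (f : ℝ × ℝ → E) (z : ℝ × ℝ) : E := fderiv ℝ f z (1, 0)

/-- Partial derivative with respect to the second variable `t`. -/
noncomputable def pT {E : Type*} [NormedAddCommGroup E] [NormedSpace ℝ E]
    (f : ℝ × ℝ → E) (z : ℝ × ℝ) : E := fderiv ℝ f z (0, 1)

/-- The cross product on three-dimensional Euclidean space. -/
noncomputable def cross3 (a b : EuclideanSpace ℝ (Fin 3)) : EuclideanSpace ℝ (Fin 3) :=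
  (EuclideanSpace.equiv (Fin 3) ℝ).symm
    (crossProduct ((EuclideanSpace.equiv (Fin 3) ℝ) a) ((EuclideanSpace.equiv (Fin 3) ℝ) b))

lemma cross3_diff {f g : ℝ × ℝ → EuclideanSpace ℝ (Fin 3)} (hf : Differentiable ℝ f)
    (hg : Differentiable ℝ g) : Differentiable ℝ (fun z => cross3 (f z) (g z)) := by
  rw [differentiable_euclidean] at *
  intro i
  have h0 := hf 0
  have h1 := hf 1
  have h2 := hf 2
  have g0 := hg 0
  have g1 := hg 1
  have g2 := hg 2
  fin_cases i <;> simp [cross3, cross_apply] <;> fun_prop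

lemma cross3_self_left (a b : EuclideanSpace ℝ (Fin 3)) : ⟪a, cross3 a b⟫_ℝ = 0 := by
  simp [cross3, cross_apply, PiLp.inner_apply, Fin.sum_univ_three]; ring

lemma cross3_self_right (a b : EuclideanSpace ℝ (Fin 3)) : ⟪b, cross3 a b⟫_ℝ = 0 := by
  simp [cross3, cross_apply, PiLp.inner_apply, Fin.sum_univ_three]; ring

lemma cross3_inner_self (a b : EuclideanSpace ℝ (Fin 3)) :
    ⟪cross3 a b, cross3 a b⟫_ℝ = ⟪a, a⟫_ℝ * ⟪b, b⟫_ℝ - ⟪a, b⟫_ℝ ^ 2 := by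
  simp only [PiLp.inner_apply, Fin.sum_univ_three]
  simp [cross3, cross_apply]; ring

lemma cross3_triple (a b c : EuclideanSpace ℝ (Fin 3)) :
    ⟪a, cross3 b c⟫_ℝ = - ⟪b, cross3 a c⟫_ℝ := by
  simp [cross3, cross_apply, PiLp.inner_apply, Fin.sum_univ_three]; ring

lemma inner_const_deriv {f g : ℝ × ℝ → EuclideanSpace ℝ (Fin 3)} (hf : Differentiable ℝ f)
    (hg : Differentiable ℝ g) (c : ℝ) (h : ∀ z, ⟪f z, g z⟫_ℝ = c) (z d : ℝ × ℝ) :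
    ⟪f z, fderiv ℝ g z d⟫_ℝ + ⟪fderiv ℝ f z d, g z⟫_ℝ = 0 := by
  rw [← fderiv_inner_apply ℝ (hf z) (hg z) d]
  have : (fun t => ⟪f t, g t⟫_ℝ) = fun _ => c := funext h
  rw [this]; simp

lemma fderiv_smul_dir {a : ℝ × ℝ → ℝ} {f : ℝ × ℝ → EuclideanSpace ℝ (Fin 3)}
    (ha : Differentiable ℝ a) (hf : Differentiable ℝ f) (z d : ℝ × ℝ) :
    fderiv ℝ (fun z => a z • f z) z d = a z • fderiv ℝ f z d + fderiv ℝ a z d • f z := by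
  rw [fderiv_fun_smul (ha z) (hf z)]; simp

lemma schwarz_pXT {S : ℝ × ℝ → EuclideanSpace ℝ (Fin 3)} (hS : ContDiff ℝ 2 S) (z : ℝ × ℝ) :
    pT (pX S) z = pX (pT S) z := by
  have hd : Differentiable ℝ (fderiv ℝ S) :=
    (hS.fderiv_right (m := 1) (by norm_num)).differentiable (by norm_num)
  have key : ∀ d e : ℝ × ℝ, fderiv ℝ (fun y => fderiv ℝ S y d) z e = fderiv ℝ (fderiv ℝ S) z e d := by
    intro d e
    rw [fderiv_clm_apply (hd z) (by fun_prop)]; simp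
  have hs : IsSymmSndFDerivAt ℝ S z := hS.contDiffAt.isSymmSndFDerivAt (by simp)
  change fderiv ℝ (fun y => fderiv ℝ S y (1, 0)) z (0, 1) =
    fderiv ℝ (fun y => fderiv ℝ S y (0, 1)) z (1, 0)
  rw [key, key]
  exact hs _ _

theorem mLXIX_L_equivalent_system
    (S : ℝ × ℝ → EuclideanSpace ℝ (Fin 3))
    (hS : ContDiff ℝ 2 S)
    (hunit : ∀ z, ‖S z‖ = 1)
    (k : ℝ × ℝ → ℝ) (hk : ∀ z, k z = ‖pX S z‖) (hkpos : ∀ z, 0 < k z)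
    (u v : ℝ × ℝ → ℝ) (hu_smooth : ContDiff ℝ 1 u) (hv_smooth : ContDiff ℝ 1 v)
    (hu : ∀ z, (u z) ^ 2 < (k z) ^ 2)
    (e₁ e₂ e₃ : ℝ × ℝ → EuclideanSpace ℝ (Fin 3))
    (he₁ : ∀ z, e₁ z = S z)
    (he₂ : ∀ z, e₂ z = (k z)⁻¹ • pX S z)
    (he₃ : ∀ z, e₃ z = (k z)⁻¹ • cross3 (S z) (pX S z))
    (τ : ℝ × ℝ → ℝ) (hτ : ∀ z, τ z = ⟪pX e₂ z, e₃ z⟫_ℝ)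
    (ω₂ ω₃ : ℝ × ℝ → ℝ)
    (hω₂ : ∀ z, ω₂ z = -u z)
    (hω₃ : ∀ z, ω₃ z = -Real.sqrt ((k z) ^ 2 - (u z) ^ 2))
    (hgauge : ∀ z, ⟪pT e₂ z, e₃ z⟫_ℝ = 0)
    (heq1 : ∀ z, pT S z = (k z)⁻¹ •
      ((-Real.sqrt ((k z) ^ 2 - (u z) ^ 2)) • pX S z + u z • cross3 (S z) (pX S z)))
    (heq2 : ∀ z, pX u z = v z * Real.sqrt (‖pT S z‖ ^ 2 - (u z) ^ 2))
    (heq3 : ∀ z, pT v z = -⟪S z, cross3 (pT S z) (pX S z)⟫_ℝ) :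
    ∀ z, pT k z = pX ω₃ z + τ z * ω₂ z ∧
      pT τ z = -(k z * ω₂ z) ∧
      pX ω₂ z = τ z * ω₃ z := by
  have hd : ContDiff ℝ 1 (fderiv ℝ S) := hS.fderiv_right (m := 1) (by norm_num)
  have hSd : Differentiable ℝ S := hS.differentiable (by norm_num)
  have hX1 : ContDiff ℝ 1 (pX S) := by
    unfold pX; exact hd.clm_apply contDiff_const
  have hXd : Differentiable ℝ (pX S) := hX1.differentiable (by norm_num)
  have hkne : ∀ z, k z ≠ 0 := fun z => (hkpos z).ne'
  have hkd : Differentiable ℝ k := by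
    have : k = fun z => ‖pX S z‖ := funext hk
    rw [this]
    exact hXd.norm ℝ (fun z => by
      have := hkpos z
      rw [hk] at this
      exact norm_pos_iff.mp this)
  have hud : Differentiable ℝ u := hu_smooth.differentiable (by norm_num)
  have hpos : ∀ z, 0 < k z ^ 2 - u z ^ 2 := fun z => by linarith [hu z]
  have hω₃d : Differentiable ℝ ω₃ := by
    have : ω₃ = fun z => -Real.sqrt ((k z) ^ 2 - (u z) ^ 2) := funext hω₃
    rw [this]
    exact (Differentiable.sqrt (by fun_prop) (fun z => (hpos z).ne')).neg
  have hkid : Differentiable ℝ (fun z => (k z)⁻¹) := hkd.inv hkne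
  have he₂d : Differentiable ℝ e₂ := by
    rw [show e₂ = _ from funext he₂]; exact hkid.smul hXd
  have he₃d : Differentiable ℝ e₃ := by
    rw [show e₃ = _ from funext he₃]; exact hkid.smul (cross3_diff hSd hXd)
  have hSS : ∀ z, ⟪S z, S z⟫_ℝ = 1 := fun z => by
    rw [real_inner_self_eq_norm_sq, hunit]; norm_num
  have hXX : ∀ z, ⟪pX S z, pX S z⟫_ℝ = k z ^ 2 := fun z => by
    rw [real_inner_self_eq_norm_sq, hk]
  have hSX : ∀ z, ⟪S z, pX S z⟫_ℝ = 0 := fun z => by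
    have h := inner_const_deriv hSd hSd 1 hSS z (1, 0)
    rw [real_inner_comm (S z) (fderiv ℝ S z (1, 0))] at h
    change ⟪S z, fderiv ℝ S z (1, 0)⟫_ℝ = 0
    first | linarith | (rw [real_inner_comm] at h ⊢; linarith)
  have hCC : ∀ z, ⟪cross3 (S z) (pX S z), cross3 (S z) (pX S z)⟫_ℝ = k z ^ 2 := fun z => by
    rw [cross3_inner_self, hSS, hXX, hSX]; ring
  have h22 : ∀ z, ⟪e₂ z, e₂ z⟫_ℝ = 1 := fun z => by
    have := hkne z
    rw [he₂, real_inner_smul_left, real_inner_smul_right, hXX]; field_simp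
  have h33 : ∀ z, ⟪e₃ z, e₃ z⟫_ℝ = 1 := fun z => by
    have := hkne z
    rw [he₃, real_inner_smul_left, real_inner_smul_right, hCC]; field_simp
  have h23 : ∀ z, ⟪e₂ z, e₃ z⟫_ℝ = 0 := fun z => by
    rw [he₂, he₃, real_inner_smul_left, real_inner_smul_right, cross3_self_right]; simp
  have hX : pX S = fun z => k z • e₂ z := by
    funext z
    rw [he₂, smul_smul, mul_inv_cancel₀ (hkne z), one_smul]
  have hT : pT S = fun z => ω₃ z • e₂ z + u z • e₃ z := by
    funext z
    rw [heq1, he₂, he₃, hω₃]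
    simp only [smul_add, smul_smul]
    congr 2 <;> ring
  have hu2 : ∀ z, pX u z = - (τ z * ω₃ z) ∧ pT k z = pX ω₃ z - u z * τ z := by
    intro z
    have hsch := schwarz_pXT hS z
    rw [hX, hT] at hsch
    unfold pT pX at hsch
    rw [fderiv_smul_dir hkd he₂d, fderiv_fun_add ((hω₃d.fun_smul he₂d) z) ((hud.fun_smul he₃d) z),
      add_apply, fderiv_smul_dir hω₃d he₂d, fderiv_smul_dir hud he₃d] at hsch
    have a1 := inner_const_deriv he₂d he₂d 1 h22 z (0, 1)
    have a2 := inner_const_deriv he₂d he₂d 1 h22 z (1, 0)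
    have a3 := inner_const_deriv he₃d he₃d 1 h33 z (1, 0)
    have a4 := inner_const_deriv he₂d he₃d 0 h23 z (1, 0)
    have g := hgauge z
    have t := hτ z
    unfold pT at g
    unfold pX at t
    rw [real_inner_comm] at g t
    rw [real_inner_comm (e₂ z) (fderiv ℝ e₂ z _)] at a1 a2
    rw [real_inner_comm (e₃ z) (fderiv ℝ _ z _)] at a3 a4
    have i2 := congrArg (fun w => ⟪e₂ z, w⟫_ℝ) hsch
    have i3 := congrArg (fun w => ⟪e₃ z, w⟫_ℝ) hsch
    have h32 : ⟪e₃ z, e₂ z⟫_ℝ = 0 := by rw [real_inner_comm]; exact h23 z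
    simp only [inner_add_right, real_inner_smul_right, h22, h33, h23, h32, g, ← t] at i2 i3
    have b1 : ⟪e₂ z, fderiv ℝ e₂ z (0, 1)⟫_ℝ = 0 := by
      rw [real_inner_comm] at a1 ⊢; linarith
    have b2 : ⟪e₂ z, fderiv ℝ e₂ z (1, 0)⟫_ℝ = 0 := by
      linarith
    have b3 : ⟪e₃ z, fderiv ℝ e₃ z (1, 0)⟫_ℝ = 0 := by
      linarith
    have b4 : ⟪e₂ z, fderiv ℝ e₃ z (1, 0)⟫_ℝ = - τ z := by
      linarith
    rw [b1, b2, b4] at i2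
    rw [b3] at i3
    unfold pX pT
    constructor <;> linarith
  have hTT : ∀ z, ‖pT S z‖ ^ 2 = k z ^ 2 := by
    intro z
    have h32 : ⟪e₃ z, e₂ z⟫_ℝ = 0 := by rw [real_inner_comm]; exact h23 z
    rw [← real_inner_self_eq_norm_sq, hT]
    simp only [inner_add_right, inner_add_left, real_inner_smul_right, real_inner_smul_left,
      h22, h33, h23, h32, hω₃]
    have := Real.mul_self_sqrt (hpos z).le
    linarith
  have hτv : τ = v := by
    funext z
    have h1 := (hu2 z).1
    rw [heq2, hTT, hω₃] at h1
    have hs := Real.sqrt_pos.mpr (hpos z)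
    have : v z * √(k z ^ 2 - u z ^ 2) = τ z * √(k z ^ 2 - u z ^ 2) := by linarith
    exact (mul_right_cancel₀ hs.ne' this).symm
  intro z
  refine ⟨?_, ?_, ?_⟩
  · rw [(hu2 z).2, hω₂]; ring
  · rw [hτv, heq3, cross3_triple, hω₂, heq1, real_inner_smul_left, inner_add_left,
      real_inner_smul_left, real_inner_smul_left, cross3_self_right, hCC]
    have := hkne z
    field_simp
    ring
  · have h1 := (hu2 z).1
    have : ω₂ = fun z => - u z := funext hω₂
    unfold pX at h1 ⊢
    rw [this, fderiv_fun_neg]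
    simp only [neg_apply]
    linarith
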